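/- Let X be a smooth projective variety of dimension d over a field k with an ample line bundle O(1). Then for every coherent sheaf E on X there exists a coherent sheaf F and a bounded complex K• = [O(-n_d)^{⊕m_d} → ... → O(-n_0)^{⊕m_0}] of direct sums of twists of O(-1) such that E ⊕ F[d] ≅ K• in the bounded derived category D^b(X). -/

import Mathlib

/-!
STATEMENT 2: Let X be a smooth projective variety of dimension d over a field k with an
ample line bundle O(1). Then every coherent sheaf E satisfies E ⊕ F[d] ≅ K• in D^b(X)
for some coherent sheaf F and some bounded complex K• = [O(-n_d)^{m_d} → ... → O(-n_0)^{m_0}].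

Since coherent sheaves on projective varieties are not available in Mathlib, the
situation is formalized faithfully through its homological content: `C` is a k-linear
abelian category (the category Coh(X) of coherent sheaves), `O : ℤ → C` is the family
of twists O(n) of the ample line bundle, `hample` says that every object is a quotient
of a finite direct sum O(-n)^{⊕m} (Serre's theorem for the ample O(1)), and `hdim`
says Ext^{d+1}(E,F) = 0 (X is smooth of dimension d).  The conclusion is stated in the
derived category, with K• a complex concentrated in degrees [-d, 0] whose terms are
finite direct sums of objects O(-n).
-/

open CategoryTheory Limits Abelian

universe w v u

attribute [local instance] CategoryTheory.Abelian.hasFiniteBiproducts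

section

variable {C : Type u} [Category.{v} C] [Abelian C]

namespace CochainComplex

lemma mappingCone_X_zero_iso {K L : CochainComplex C ℤ} (φ : K ⟶ L) (hK : IsZero (K.X 1)) :
    Nonempty ((mappingCone φ).X 0 ≅ L.X 0) :=
  ⟨HomologicalComplex.homotopyCofiber.XIsoBiprod φ 0 1 (by simp) ≪≫ (isoZeroBiprod hK).symm⟩

lemma mappingCone_X_iso_of_isZero {K L : CochainComplex C ℤ} (φ : K ⟶ L) (i : ℤ)
    (hL : IsZero (L.X i)) :
    Nonempty ((mappingCone φ).X i ≅ K.X (i + 1)) :=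
  ⟨HomologicalComplex.homotopyCofiber.XIsoBiprod φ i (i + 1) (by simp) ≪≫
    (isoBiprodZero hL).symm⟩

end CochainComplex

namespace DerivedCategory

variable [HasDerivedCategory.{w} C]

open Pretriangulated
open CochainComplex hiding shiftFunctor shiftFunctorZero' shiftFunctorAdd'

/-- A morphism in the derived category from the mapping cone of a morphism `φ : K ⟶ L` to an
object in the heart is determined by its restriction to `L` if `K` is zero in positive degrees. -/
lemma Q_mappingCone_hom_ext {K L : CochainComplex C ℤ} (φ : K ⟶ L) [K.IsStrictlyLE 0] {E : C}
    {f g : Q.obj (mappingCone φ) ⟶ (singleFunctor C 0).obj E}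
    (h : Q.map (mappingCone.inr φ) ≫ f = Q.map (mappingCone.inr φ) ≫ g) : f = g := by
  rw [← sub_eq_zero]
  obtain ⟨a, ha⟩ := Triangle.yoneda_exact₃ _ (mappingCone_triangle_distinguished φ) (f - g)
    (by
      change Q.map (mappingCone.inr φ) ≫ (f - g) = 0
      rw [Preadditive.comp_sub, h, sub_self])
  have : (Q.obj K).IsLE 0 := inferInstance
  have h₁ : TStructure.t.IsLE ((Q.obj K)⟦(1 : ℤ)⟧) (-1) := TStructure.t.isLE_shift _ 0 1 (-1)
  have h₀ : TStructure.t.IsGE ((singleFunctor C 0).obj E) 0 :=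
    inferInstanceAs (IsGE ((singleFunctor C 0).obj E) 0)
  have ha₀ : a = 0 := TStructure.t.zero_of_isLE_of_isGE a (-1) 0 (by lia) h₁ h₀
  rw [ha, ha₀]
  exact comp_zero

/-- Any object `E` has a left resolution of length `n` by objects satisfying `P`, up to
an error term `F` which contributes to the cone only via a shift by `n`. -/
lemma exists_distTriang_left_resolution (P : ObjectProperty C) [P.IsClosedUnderIsomorphisms]
    (hP : ∀ E : C, ∃ (X : C) (p : X ⟶ E), P X ∧ Epi p) (n : ℕ) (E : C) :
    ∃ (F : C) (K : CochainComplex C ℤ) (π : K ⟶ (CochainComplex.singleFunctor C 0).obj E)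
      (Y : DerivedCategory C) (v : (singleFunctor C 0).obj E ⟶ Y) (δ : Y ⟶ (Q.obj K)⟦(1 : ℤ)⟧),
      (∀ i : ℤ, (i ≤ -(n : ℤ) ∨ 0 < i) → IsZero (K.X i)) ∧
      (∀ i : ℤ, -(n : ℤ) < i → i ≤ 0 → P (K.X i)) ∧
      Triangle.mk (Q.map π) v δ ∈ distTriang (DerivedCategory C) ∧
      Nonempty (Y ≅ ((singleFunctor C 0).obj F)⟦(n : ℤ)⟧) := by
  induction n generalizing E with
  | zero =>
    let Z : CochainComplex C ℤ := HomologicalComplex.zero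
    have hZ₀ : IsZero Z := HomologicalComplex.isZero_zero
    refine ⟨E, Z, 0, (singleFunctor C 0).obj E, 𝟙 _, 0, fun i _ ↦ ?_, fun i _ _ ↦ by lia, ?_,
      ⟨((shiftFunctorZero' (DerivedCategory C) ((0 : ℕ) : ℤ) (by simp)).app _).symm⟩⟩
    · exact Functor.map_isZero (HomologicalComplex.eval C _ i) hZ₀
    · have hZ : IsZero (Q.obj Z) := Functor.map_isZero _ hZ₀
      refine isomorphic_distinguished _
        (contractible_distinguished₁ ((singleFunctor C 0).obj E)) _ ?_
      exact Triangle.isoMk _ _ (hZ.iso (isZero_zero _)) (Iso.refl _) (Iso.refl _)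
        (hZ.eq_of_src _ _)
        ((Category.comp_id _).trans (Category.id_comp _).symm)
        (zero_comp.trans comp_zero.symm)
  | succ n ih =>
    obtain ⟨X, p, hX, _⟩ := hP E
    obtain ⟨F, K, π, Y, v, δ, hK₀, hK, hT, ⟨e⟩⟩ := ih (kernel p)
    let S : ShortComplex C := ShortComplex.mk (kernel.ι p) p (by simp)
    have hS : S.ShortExact :=
      { exact := ShortComplex.exact_of_f_is_kernel _ (kernelIsKernel p)
        mono_f := inferInstanceAs (Mono (kernel.ι p))
        epi_g := inferInstanceAs (Epi p) }
    have hS' := hS.map_of_exact (HomologicalComplex.single C (ComplexShape.up ℤ) 0)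
    have hT' := triangleOfSES_distinguished hS'
    let j := (CochainComplex.singleFunctor C 0).map (kernel.ι p)
    let q := (CochainComplex.singleFunctor C 0).map p
    have hjq : j ≫ q = 0 := by
      rw [← Functor.map_comp, kernel.condition, Functor.map_zero]
    let φ := π ≫ j
    let π' : mappingCone φ ⟶ (CochainComplex.singleFunctor C 0).obj E :=
      mappingCone.desc φ 0 q (by simp [φ, hjq])
    have : K.IsStrictlyLE 0 := by
      rw [isStrictlyLE_iff]
      exact fun i hi ↦ hK₀ i (Or.inr hi)
    have o := Triangulated.someOctahedron (Q.map_comp π j).symm hT hT'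
      (mappingCone_triangle_distinguished φ)
    have hm : o.m₃ = Q.map π' := by
      apply Q_mappingCone_hom_ext
      have hq : Q.map (mappingCone.inr φ) ≫ Q.map π' = Q.map q := by
        rw [← Q.map_comp, mappingCone.inr_desc]
      exact o.comm₃.trans hq.symm
    have hπ' := rot_of_distTriang _ o.mem
    refine ⟨F, mappingCone φ, π', Y⟦(1 : ℤ)⟧, _, _, fun i hi ↦ ?_, fun i hi hi₀ ↦ ?_,
      by rw [← hm]; exact hπ', ⟨(shiftFunctor _ (1 : ℤ)).mapIso e ≪≫
        ((shiftFunctorAdd' (DerivedCategory C) (n : ℤ) 1 ((n + 1 : ℕ) : ℤ)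
          (by simp)).app _).symm⟩⟩
    · obtain ⟨e⟩ := mappingCone_X_iso_of_isZero φ i
        (HomologicalComplex.isZero_single_obj_X _ _ _ _ (by lia))
      exact (hK₀ (i + 1) (by lia)).of_iso e
    · by_cases h : i = 0
      · subst h
        obtain ⟨e⟩ := mappingCone_X_zero_iso φ (hK₀ 1 (by lia))
        exact P.prop_of_iso (e ≪≫ HomologicalComplex.singleObjXSelf _ _ _).symm hX
      · obtain ⟨e⟩ := mappingCone_X_iso_of_isZero φ i
          (HomologicalComplex.isZero_single_obj_X _ _ _ _ h)
        exact P.prop_of_iso e.symm (hK (i + 1) (by lia) (by lia))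

end DerivedCategory

end

variable (k : Type*) [Field k]
variable (C : Type u) [Category.{v} C] [Abelian C] [Linear k C]
  [HasDerivedCategory.{w} C] [HasExt.{w} C]

theorem stmt2 (d : ℕ) (O : ℤ → C)
    (hample : ∀ E : C, ∃ (n : ℤ) (m : ℕ) (p : (⨁ fun _ : Fin m => O (-n)) ⟶ E), Epi p)
    (hdim : ∀ E F : C, Subsingleton (Abelian.Ext E F (d + 1)))
    (E : C) :
    ∃ (F : C) (K : CochainComplex C ℤ),
      (∀ i : ℤ, (i < -(d : ℤ) ∨ 0 < i) → IsZero (K.X i)) ∧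
      (∀ i : ℤ, -(d : ℤ) ≤ i → i ≤ 0 →
        ∃ (n : ℤ) (m : ℕ), Nonempty (K.X i ≅ ⨁ fun _ : Fin m => O (-n))) ∧
      Nonempty ((DerivedCategory.singleFunctor C 0).obj E ⊞
          (((DerivedCategory.singleFunctor C 0).obj F)⟦(d : ℤ)⟧) ≅
        DerivedCategory.Q.obj K) := by
  let P : ObjectProperty C := fun X ↦
    ∃ (n : ℤ) (m : ℕ), Nonempty (X ≅ ⨁ fun _ : Fin m => O (-n))
  have : P.IsClosedUnderIsomorphisms :=
    ⟨fun e ⟨n, m, ⟨e'⟩⟩ ↦ ⟨n, m, ⟨e.symm ≪≫ e'⟩⟩⟩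
  obtain ⟨F, K, π, Y, v, δ, hK₀, hK, hT, ⟨e⟩⟩ :=
    DerivedCategory.exists_distTriang_left_resolution P
      (fun E ↦ by
        obtain ⟨n, m, p, hp⟩ := hample E
        exact ⟨_, p, ⟨n, m, ⟨Iso.refl _⟩⟩, hp⟩) (d + 1) E
  have hv : v = 0 := by
    have := (Abelian.Ext.homEquiv (X := E) (Y := F) (n := d + 1)).symm.subsingleton
    rw [← cancel_mono e.hom]
    exact Subsingleton.elim (α := ShiftedHom _ _ _) _ _
  obtain ⟨e', -⟩ := Pretriangulated.exists_iso_binaryBiproduct_of_distTriang _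
    (Pretriangulated.inv_rot_of_distTriang _ hT) (by subst hv; exact zero_comp)
  refine ⟨F, K, fun i hi ↦ hK₀ i (by lia), fun i hi hi' ↦ hK i (by lia) hi', ⟨?_⟩⟩
  exact biprod.braiding _ _ ≪≫ biprod.mapIso
    ((shiftFunctorAdd' (DerivedCategory C) ((d + 1 : ℕ) : ℤ) (-1) (d : ℤ) (by simp)).app _ ≪≫
      (shiftFunctor _ (-1 : ℤ)).mapIso e.symm) (Iso.refl _) ≪≫ e'.symm
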